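/- Relative entropy at a fixed time between a Black–Scholes marginal and a Brownian marginal: Let t > 0, let Γ ∈ ℝ^{l×l} be invertible, let μ_t be the pushforward of the Gaussian distribution N_l(m, t Γ Γ^T) with m_i = −(t/2) Σ_{k=1}^l Γ_{ik}^2 under the coordinatewise exponential map x ↦ (e^{x_1},…,e^{x_l}) (i.e. the law of the time-t marginal of the martingale Black–Scholes model with parameter Γ started at 𝟏), and let ν_t = N_l(𝟏, t I) (the time-t marginal of Brownian motion started at 𝟏). Then H(μ_t | ν_t) = (1/2)( − log det(Γ Γ^T) + t Σ_{i=1}^l Σ_{k=1}^l Γ_{ik}^2 − l + Σ_{i=1}^l ( e^{t Σ_{k=1}^l Γ_{ik}^2} − 1 ) / t ). -/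

import Mathlib

open MeasureTheory ProbabilityTheory Filter Set
open scoped ENNReal NNReal Matrix Classical

noncomputable section

/-- Relative entropy `H(μ|ν) = ∫ log (dμ/dν) dμ` if `μ ≪ ν` (and the integral exists),
`+∞` otherwise. -/
def relEnt {α : Type*} [MeasurableSpace α] (μ ν : Measure α) : EReal :=
  if μ ≪ ν ∧ Integrable (fun x => Real.log (μ.rnDeriv ν x).toReal) μ then
    ((∫ x, Real.log (μ.rnDeriv ν x).toReal ∂μ : ℝ) : EReal)
  else ⊤

/-- The Gaussian measure `N_l(m, S)` on `ℝ^l` (for `S` positive definite), given through its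
density with respect to Lebesgue measure. -/
def multiGaussian (l : ℕ) (m : Fin l → ℝ) (S : Matrix (Fin l) (Fin l) ℝ) :
    Measure (Fin l → ℝ) :=
  volume.withDensity fun x =>
    ENNReal.ofReal (Real.exp (-(1/2) * ((x - m) ⬝ᵥ (S⁻¹ *ᵥ (x - m)))) /
      Real.sqrt ((2 * Real.pi) ^ l * S.det))

lemma map_withDensity_cov {l : ℕ} (T : (Fin l → ℝ) → (Fin l → ℝ))
    (T' : (Fin l → ℝ) → ((Fin l → ℝ) →L[ℝ] (Fin l → ℝ)))
    (hT : ∀ x, HasFDerivAt T (T' x) x) (hinj : Function.Injective T)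
    (g h : (Fin l → ℝ) → ℝ≥0∞)
    (hgh : ∀ x, g x = ENNReal.ofReal |(T' x).det| * h (T x)) (hr : MeasurableSet (range T)) :
    (volume.withDensity g).map T = volume.withDensity ((range T).indicator h) := by
  have hTm : Measurable T :=
    (continuous_iff_continuousAt.2 fun x => (hT x).continuousAt).measurable
  ext s hs
  rw [Measure.map_apply hTm hs, withDensity_apply _ (hTm hs), withDensity_apply _ hs,
    lintegral_indicator hr, Measure.restrict_restrict hr]
  have := lintegral_image_eq_lintegral_abs_det_fderiv_mul (volume : Measure (Fin l → ℝ))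
    (hTm hs) (fun x _ => (hT x).hasFDerivWithinAt) hinj.injOn h
  rw [image_preimage_eq_inter_range, inter_comm] at this
  rw [this]
  simp_rw [hgh]

lemma pi_gaussian (l : ℕ) :
    Measure.pi (fun _ : Fin l => gaussianReal 0 1) = volume.withDensity
      (fun z => ENNReal.ofReal (∏ i, gaussianPDFReal 0 1 (z i))) := by
  refine (Measure.pi_eq fun s hs => ?_)
  rw [withDensity_apply _ (MeasurableSet.univ_pi hs), ← lintegral_indicator (MeasurableSet.univ_pi hs)]
  have h1 : ∀ z : Fin l → ℝ, (univ.pi s).indicator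
      (fun z => ENNReal.ofReal (∏ i, gaussianPDFReal 0 1 (z i))) z =
      ENNReal.ofReal (∏ i, (s i).indicator (gaussianPDFReal 0 1) (z i)) := by
    intro z
    by_cases hz : z ∈ univ.pi s
    · rw [indicator_of_mem hz]
      congr 1
      exact Finset.prod_congr rfl fun i _ => (indicator_of_mem (hz i trivial) _).symm
    · rw [indicator_of_notMem hz]
      simp only [Set.mem_pi, mem_univ, true_imp_iff, not_forall] at hz
      obtain ⟨i, hi⟩ := hz
      rw [Finset.prod_eq_zero (Finset.mem_univ i) (indicator_of_notMem hi _), ENNReal.ofReal_zero]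
  simp_rw [h1]
  rw [← ofReal_integral_eq_lintegral_ofReal]
  · rw [integral_fintype_prod_volume_eq_prod (fun i => (s i).indicator (gaussianPDFReal 0 1)),
      ENNReal.ofReal_prod_of_nonneg]
    · refine Finset.prod_congr rfl fun i _ => ?_
      rw [gaussianReal_apply_eq_integral _ one_ne_zero, integral_indicator (hs i)]
    · intro i _
      exact integral_nonneg fun x => indicator_nonneg (fun _ _ => gaussianPDFReal_nonneg _ _ _) _
  · exact Integrable.fintype_prod (f := fun i => (s i).indicator (gaussianPDFReal 0 1))
      fun i => (integrable_gaussianPDFReal 0 1).indicator (hs i)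
  · exact ae_of_all _ fun z => Finset.prod_nonneg fun i _ =>
      indicator_nonneg (fun _ _ => gaussianPDFReal_nonneg _ _ _) _

lemma prod_gaussianPDF {l : ℕ} (z : Fin l → ℝ) :
    ∏ i, gaussianPDFReal 0 1 (z i) = Real.exp (-(1/2) * (z ⬝ᵥ z)) / Real.sqrt ((2 * Real.pi) ^ l) := by
  simp only [gaussianPDFReal, Finset.prod_mul_distrib, ← Real.exp_sum, dotProduct]
  simp only [NNReal.coe_one, mul_one, sub_zero, Finset.prod_const, Finset.card_univ, Fintype.card_fin]
  rw [mul_comm, div_eq_mul_inv]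
  congr 2
  · rw [Finset.mul_sum]; exact Finset.sum_congr rfl fun i _ => by ring
  · rw [inv_pow, Real.sqrt_eq_rpow, Real.sqrt_eq_rpow, ← Real.rpow_natCast, ← Real.rpow_natCast,
      ← Real.rpow_mul (by positivity), ← Real.rpow_mul (by positivity), mul_comm (1 / 2 : ℝ)]

lemma det_mulVecLin {l : ℕ} (A : Matrix (Fin l) (Fin l) ℝ) :
    (LinearMap.toContinuousLinearMap (Matrix.toLin' A)).det = A.det := by
  simp [ContinuousLinearMap.det]

lemma multiGaussian_eq_map {l : ℕ} (m : Fin l → ℝ) (A : Matrix (Fin l) (Fin l) ℝ) (hA : A.det ≠ 0) :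
    multiGaussian l m (A * Aᵀ) =
      (Measure.pi (fun _ : Fin l => gaussianReal 0 1)).map (fun z => m + A *ᵥ z) := by
  have hu : IsUnit A.det := isUnit_iff_ne_zero.2 hA
  have hrange : range (fun z => m + A *ᵥ z) = univ := by
    rw [range_eq_univ]
    intro y
    exact ⟨A⁻¹ *ᵥ (y - m), by simp [Matrix.mul_nonsing_inv _ hu]⟩
  rw [pi_gaussian, map_withDensity_cov (fun z => m + A *ᵥ z)
    (fun _ => LinearMap.toContinuousLinearMap (Matrix.toLin' A)) (h := fun x =>
    ENNReal.ofReal (Real.exp (-(1/2) * ((x - m) ⬝ᵥ ((A * Aᵀ)⁻¹ *ᵥ (x - m)))) /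
      Real.sqrt ((2 * Real.pi) ^ l * (A * Aᵀ).det)))]
  · rw [hrange, indicator_univ, multiGaussian]
  · intro x
    exact (LinearMap.toContinuousLinearMap (Matrix.toLin' A)).hasFDerivAt.const_add m
  · intro x y hxy
    exact Matrix.mulVec_injective_of_isUnit ((Matrix.isUnit_iff_isUnit_det _).2 hu) (add_left_cancel hxy)
  · intro z
    rw [det_mulVecLin, ← ENNReal.ofReal_mul (abs_nonneg _), prod_gaussianPDF]
    congr 1
    have h1 : (A *ᵥ z) ⬝ᵥ ((A * Aᵀ)⁻¹ *ᵥ (A *ᵥ z)) = z ⬝ᵥ z := by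
      rw [Matrix.mul_inv_rev, Matrix.mulVec_mulVec, Matrix.mul_assoc, Matrix.nonsing_inv_mul _ hu,
        Matrix.mul_one, Matrix.dotProduct_mulVec, ← Matrix.transpose_nonsing_inv,
        Matrix.vecMul_transpose, Matrix.mulVec_mulVec, Matrix.nonsing_inv_mul _ hu, Matrix.one_mulVec]
    rw [add_sub_cancel_left, h1, Matrix.det_mul, Matrix.det_transpose, Real.sqrt_mul (by positivity),
      Real.sqrt_mul_self_eq_abs]
    have := abs_pos.2 hA
    field_simp
  · rw [hrange]; exact MeasurableSet.univ

lemma map_exp {l : ℕ} (g : (Fin l → ℝ) → ℝ) :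
    (volume.withDensity (fun x => ENNReal.ofReal (g x))).map (fun x i => Real.exp (x i)) =
    volume.withDensity ({y : Fin l → ℝ | ∀ i, 0 < y i}.indicator
      (fun y => ENNReal.ofReal (g (fun i => Real.log (y i)) / ∏ i, y i))) := by
  have hrange : range (fun (x : Fin l → ℝ) i => Real.exp (x i)) = {y : Fin l → ℝ | ∀ i, 0 < y i} := by
    ext y
    constructor
    · rintro ⟨x, rfl⟩ i
      exact Real.exp_pos _
    · intro hy
      exact ⟨fun i => Real.log (y i), funext fun i => Real.exp_log (hy i)⟩
  rw [← hrange]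
  refine map_withDensity_cov _ (fun x => LinearMap.toContinuousLinearMap
    (Matrix.toLin' (Matrix.diagonal (fun i => Real.exp (x i))))) ?_ ?_ _ _ ?_ ?_
  · intro x
    rw [hasFDerivAt_pi']
    intro i
    have h := ((ContinuousLinearMap.proj (R := ℝ) (φ := fun _ : Fin l => ℝ) i).hasFDerivAt
      (x := x)).exp
    have e : (ContinuousLinearMap.proj i ∘SL LinearMap.toContinuousLinearMap
        (Matrix.toLin' (Matrix.diagonal fun i => Real.exp (x i)))) =
        Real.exp (x i) • ContinuousLinearMap.proj (R := ℝ) (φ := fun _ : Fin l => ℝ) i := by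
      ext v
      simp [Matrix.mulVec_diagonal]
    rw [e]
    exact h
  · intro x y h
    funext i
    exact Real.exp_injective (congrFun h i)
  · intro x
    rw [det_mulVecLin, Matrix.det_diagonal, ← ENNReal.ofReal_mul (abs_nonneg _)]
    have hp : 0 < ∏ i, Real.exp (x i) := Finset.prod_pos fun i _ => Real.exp_pos _
    rw [abs_of_pos hp]
    simp only [Real.log_exp]
    congr 1
    field_simp
  · rw [hrange, Set.ofPred_forall]
    exact MeasurableSet.iInter fun i => measurableSet_lt measurable_const (measurable_pi_apply i)

lemma exp_lin {l : ℕ} (a : Fin l → ℝ) :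
    Integrable (fun z : Fin l → ℝ => Real.exp (∑ k, a k * z k))
      (Measure.pi (fun _ : Fin l => gaussianReal 0 1)) ∧
    ∫ z : Fin l → ℝ, Real.exp (∑ k, a k * z k) ∂(Measure.pi (fun _ : Fin l => gaussianReal 0 1))
      = Real.exp ((∑ k, a k ^ 2) / 2) := by
  simp_rw [Real.exp_sum]
  constructor
  · exact Integrable.fintype_prod (f := fun k x => Real.exp (a k * x))
      fun k => integrable_exp_mul_gaussianReal (a k)
  · rw [integral_fintype_prod_eq_prod (fun k x => Real.exp (a k * x)), Finset.sum_div, Real.exp_sum]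
    refine Finset.prod_congr rfl fun k _ => ?_
    have := congrFun (mgf_id_gaussianReal (μ := 0) (v := 1)) (a k)
    simpa [mgf] using this

lemma lin_int {l : ℕ} (a : Fin l → ℝ) :
    Integrable (fun z : Fin l → ℝ => ∑ k, a k * z k)
      (Measure.pi (fun _ : Fin l => gaussianReal 0 1)) ∧
    ∫ z : Fin l → ℝ, ∑ k, a k * z k ∂(Measure.pi (fun _ : Fin l => gaussianReal 0 1)) = 0 := by
  have h0 : Integrable (fun x : ℝ => x) (gaussianReal 0 1) := by
    simpa using! (memLp_id_gaussianReal (μ := 0) (v := 1) 1).integrable le_rfl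
  have h1 : ∀ k : Fin l, Integrable (fun z : Fin l → ℝ => z k)
      (Measure.pi (fun _ : Fin l => gaussianReal 0 1)) := fun k =>
    (measurePreserving_eval (fun _ : Fin l => gaussianReal 0 1) k).integrable_comp_of_integrable h0
  refine ⟨integrable_finsetSum _ fun k _ => (h1 k).const_mul _, ?_⟩
  rw [integral_finsetSum _ fun k _ => (h1 k).const_mul _]
  refine Finset.sum_eq_zero fun k _ => ?_
  rw [integral_const_mul, integral_comp_eval (μ := fun _ : Fin l => gaussianReal 0 1)
    (f := fun x : ℝ => x) (by fun_prop), integral_id_gaussianReal, mul_zero]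

lemma sq_int {l : ℕ} (k : Fin l) :
    Integrable (fun z : Fin l → ℝ => z k ^ 2)
      (Measure.pi (fun _ : Fin l => gaussianReal 0 1)) ∧
    ∫ z : Fin l → ℝ, z k ^ 2 ∂(Measure.pi (fun _ : Fin l => gaussianReal 0 1)) = 1 := by
  have h2 : MemLp (fun x : ℝ => x) 2 (gaussianReal 0 1) := by
    simpa using! (memLp_id_gaussianReal (μ := 0) (v := 1) 2)
  have h0 : Integrable (fun x : ℝ => x ^ 2) (gaussianReal 0 1) := h2.integrable_sq
  refine ⟨(measurePreserving_eval (fun _ : Fin l => gaussianReal 0 1) k).integrable_comp_of_integrable h0, ?_⟩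
  rw [integral_comp_eval (μ := fun _ : Fin l => gaussianReal 0 1)
    (f := fun x : ℝ => x ^ 2) (by fun_prop)]
  have := variance_fun_id_gaussianReal (μ := 0) (v := 1)
  rw [variance_eq_sub h2] at this
  simpa using this

lemma rn_core {l : ℕ} (g n : (Fin l → ℝ) → ℝ) (hg : Measurable g) (hn : Measurable n)
    (hg0 : ∀ x, 0 < g x) (hn0 : ∀ x, 0 < n x) :
    let μ := (volume.withDensity (fun x => ENNReal.ofReal (g x))).map (fun x i => Real.exp (x i))
    let ν := volume.withDensity (fun x => ENNReal.ofReal (n x))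
    μ ≪ ν ∧ ∀ᵐ x ∂(volume.withDensity (fun x => ENNReal.ofReal (g x))),
      Real.log (μ.rnDeriv ν (fun i => Real.exp (x i))).toReal =
        Real.log (g x) - ∑ i, x i - Real.log (n (fun i => Real.exp (x i))) := by
  intro μ ν
  set h := ({y : Fin l → ℝ | ∀ i, 0 < y i}.indicator
      (fun y => ENNReal.ofReal (g (fun i => Real.log (y i)) / ∏ i, y i))) with hh
  have hpos : MeasurableSet {y : Fin l → ℝ | ∀ i, 0 < y i} := by
    rw [Set.ofPred_forall]
    exact MeasurableSet.iInter fun i => measurableSet_lt measurable_const (measurable_pi_apply i)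
  have hhm : Measurable h := by
    refine Measurable.indicator ?_ hpos
    fun_prop
  have hnm : Measurable (fun x => ENNReal.ofReal (n x)) := by fun_prop
  set f := fun y => h y / ENNReal.ofReal (n y) with hf
  have hfm : Measurable f := hhm.div hnm
  have hE : Measurable (fun (x : Fin l → ℝ) i => Real.exp (x i)) := by fun_prop
  have hμ : μ = ν.withDensity f := by
    change Measure.map _ _ = _
    rw [map_exp, ← hh]
    change _ = (volume.withDensity _).withDensity f
    rw [← withDensity_mul _ hnm hfm]
    congr 1
    funext y
    simp only [hf, Pi.mul_apply]
    rw [ENNReal.mul_div_cancel (by simpa using hn0 y) ENNReal.ofReal_ne_top]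
  have hac : μ ≪ ν := by rw [hμ]; exact withDensity_absolutelyContinuous _ _
  refine ⟨hac, ?_⟩
  have : SigmaFinite ν := SigmaFinite.withDensity_ofReal _
  have h1 : μ.rnDeriv ν =ᵐ[μ] f := by
    apply hac.ae_le
    rw [hμ]
    exact Measure.rnDeriv_withDensity ν hfm
  have h2 := ae_of_ae_map hE.aemeasurable h1
  filter_upwards [h2] with x hx
  rw [hx]
  have hp : 0 < ∏ i, Real.exp (x i) := Finset.prod_pos fun i _ => Real.exp_pos _
  simp only [hf, hh]
  rw [indicator_of_mem (show (fun i => Real.exp (x i)) ∈ {y : Fin l → ℝ | ∀ i, 0 < y i} from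
    fun i => Real.exp_pos _)]
  simp only [Real.log_exp]
  rw [ENNReal.toReal_div, ENNReal.toReal_ofReal (div_pos (hg0 x) hp).le,
    ENNReal.toReal_ofReal (hn0 _).le, Real.log_div (div_pos (hg0 x) hp).ne' (hn0 _).ne',
    Real.log_div (hg0 x).ne' hp.ne', ← Real.exp_sum, Real.log_exp]

lemma int_five {α : Type*} [MeasurableSpace α] {P : Measure α} [IsProbabilityMeasure P]
    {f₁ f₂ f₃ f₄ : α → ℝ} (h₁ : Integrable f₁ P) (h₂ : Integrable f₂ P) (h₃ : Integrable f₃ P)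
    (h₄ : Integrable f₄ P) (c : ℝ) :
    Integrable (fun x => f₁ x - f₂ x + f₃ x - f₄ x + c) P ∧
    ∫ x, (f₁ x - f₂ x + f₃ x - f₄ x + c) ∂P =
      ∫ x, f₁ x ∂P - ∫ x, f₂ x ∂P + ∫ x, f₃ x ∂P - ∫ x, f₄ x ∂P + c := by
  have i2 : Integrable (fun x => f₁ x - f₂ x) P := h₁.sub h₂
  have i4 : Integrable (fun x => f₁ x - f₂ x + f₃ x) P := i2.add h₃
  have i6 : Integrable (fun x => f₁ x - f₂ x + f₃ x - f₄ x) P := i4.sub h₄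
  refine ⟨i6.add (integrable_const _), ?_⟩
  rw [integral_add i6 (integrable_const _), integral_sub i4 h₄, integral_add i2 h₃,
    integral_sub h₁ h₂, integral_const]
  simp

lemma F_int {l : ℕ} (c t : ℝ) (ht : 0 < t) (Γ : Matrix (Fin l) (Fin l) ℝ) :
    let F := fun z : Fin l → ℝ => c + ∑ i, (-(1/2) * z i ^ 2
        - (-(t/2) * ∑ k, (Γ i k)^2 + ∑ k, Real.sqrt t * Γ i k * z k)
        + 1 / (2 * t) * (Real.exp (-(t/2) * ∑ k, (Γ i k)^2 + ∑ k, Real.sqrt t * Γ i k * z k) - 1) ^ 2)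
    Integrable F (Measure.pi (fun _ : Fin l => gaussianReal 0 1)) ∧
    ∫ z, F z ∂(Measure.pi (fun _ : Fin l => gaussianReal 0 1)) = c +
      ∑ i, (-(1/2) + (t/2) * ∑ k, (Γ i k)^2 + 1 / (2 * t) * (Real.exp (t * ∑ k, (Γ i k)^2) - 1)) := by
  intro F
  set γ := (Measure.pi (fun _ : Fin l => gaussianReal 0 1))
  have hi : ∀ i, Integrable (fun z : Fin l → ℝ => (-(1/2) * z i ^ 2
        - (-(t/2) * ∑ k, (Γ i k)^2 + ∑ k, Real.sqrt t * Γ i k * z k)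
        + 1 / (2 * t) * (Real.exp (-(t/2) * ∑ k, (Γ i k)^2 + ∑ k, Real.sqrt t * Γ i k * z k) - 1) ^ 2)) γ ∧
      ∫ z, (-(1/2) * z i ^ 2
        - (-(t/2) * ∑ k, (Γ i k)^2 + ∑ k, Real.sqrt t * Γ i k * z k)
        + 1 / (2 * t) * (Real.exp (-(t/2) * ∑ k, (Γ i k)^2 + ∑ k, Real.sqrt t * Γ i k * z k) - 1) ^ 2) ∂γ
      = (-(1/2) + (t/2) * ∑ k, (Γ i k)^2 + 1 / (2 * t) * (Real.exp (t * ∑ k, (Γ i k)^2) - 1)) := by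
    intro i
    obtain ⟨a1, a2⟩ := sq_int i
    obtain ⟨b1, b2⟩ := lin_int (fun k => Real.sqrt t * Γ i k)
    obtain ⟨c1, c2⟩ := exp_lin (fun k => Real.sqrt t * Γ i k)
    obtain ⟨d1, d2⟩ := exp_lin (fun k => 2 * (Real.sqrt t * Γ i k))
    set s := ∑ k, (Γ i k)^2 with hs
    have e1 : (∑ k, (Real.sqrt t * Γ i k) ^ 2) = t * s := by
      rw [hs, Finset.mul_sum]
      exact Finset.sum_congr rfl fun k _ => by rw [mul_pow, Real.sq_sqrt ht.le]
    have e2 : (∑ k, (2 * (Real.sqrt t * Γ i k)) ^ 2) = 4 * (t * s) := by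
      rw [← e1, Finset.mul_sum]
      exact Finset.sum_congr rfl fun k _ => by ring
    rw [e1] at c2
    rw [e2] at d2
    have key : ∀ z : Fin l → ℝ, (-(1/2) * z i ^ 2
        - (-(t/2) * s + ∑ k, Real.sqrt t * Γ i k * z k)
        + 1 / (2 * t) * (Real.exp (-(t/2) * s + ∑ k, Real.sqrt t * Γ i k * z k) - 1) ^ 2)
        = (((-(1/2) * z i ^ 2 - ∑ k, Real.sqrt t * Γ i k * z k)
          + (1 / (2 * t) * Real.exp (-(t * s))) * Real.exp (∑ k, 2 * (Real.sqrt t * Γ i k) * z k))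
          - (1 / t * Real.exp (-(t/2) * s)) * Real.exp (∑ k, (Real.sqrt t * Γ i k) * z k))
          + (t/2 * s + 1 / (2 * t)) := by
      intro z
      have : (∑ k, 2 * (Real.sqrt t * Γ i k) * z k) = 2 * ∑ k, Real.sqrt t * Γ i k * z k := by
        rw [Finset.mul_sum]
        exact Finset.sum_congr rfl fun k _ => by ring
      rw [this]
      set u := ∑ k, Real.sqrt t * Γ i k * z k
      have q1 : Real.exp (-(t * s)) = Real.exp (-(t/2) * s) ^ 2 := by
        rw [← Real.exp_nat_mul]; congr 1; push_cast; ring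
      have q2 : Real.exp (2 * u) = Real.exp u ^ 2 := by
        rw [← Real.exp_nat_mul]; push_cast; rfl
      rw [q1, q2, Real.exp_add]
      field_simp
      ring
    simp_rw [key]
    have i1 := a1.const_mul (-(1/2) : ℝ)
    have i3 := d1.const_mul (1 / (2 * t) * Real.exp (-(t * s)))
    have i5 := c1.const_mul (1 / t * Real.exp (-(t/2) * s))
    obtain ⟨j1, j2⟩ := int_five i1 b1 i3 i5 (t/2 * s + 1 / (2 * t))
    refine ⟨j1, j2.trans ?_⟩
    rw [integral_const_mul, integral_const_mul, integral_const_mul, a2, b2, c2, d2]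
    rw [mul_assoc (1 / (2 * t)), mul_assoc (1 / t), ← Real.exp_add, ← Real.exp_add]
    have q1 : -(t * s) + 4 * (t * s) / 2 = t * s := by ring
    have q2 : -(t / 2) * s + t * s / 2 = 0 := by ring
    rw [q1, q2, Real.exp_zero]
    simp
    field_simp
    ring
  have hI : Integrable (fun z => ∑ i, (-(1/2) * z i ^ 2
        - (-(t/2) * ∑ k, (Γ i k)^2 + ∑ k, Real.sqrt t * Γ i k * z k)
        + 1 / (2 * t) * (Real.exp (-(t/2) * ∑ k, (Γ i k)^2 + ∑ k, Real.sqrt t * Γ i k * z k) - 1) ^ 2)) γ :=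
    integrable_finsetSum _ fun i _ => (hi i).1
  refine ⟨(integrable_const c).add hI, ?_⟩
  rw [integral_add (integrable_const c) hI, integral_finsetSum _ fun i _ => (hi i).1]
  simp_rw [fun i => (hi i).2]
  simp [γ]

/-- **Relative entropy at a fixed time between a Black–Scholes marginal and a Brownian
marginal.** For `t > 0` and invertible `Γ`, letting `μ_t` be the lognormal law obtained by
pushing `N_l(m, t ΓΓᵀ)` (with `m_i = -(t/2) Σ_k Γ_{ik}²`) forward by the coordinatewise
exponential, and `ν_t = N_l(𝟏, t I)`, one has
`H(μ_t|ν_t) = (1/2)(-log det(ΓΓᵀ) + t Σ_i Σ_k Γ_{ik}² - l + Σ_i (e^{t Σ_k Γ_{ik}²} - 1)/t)`. -/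
theorem relEnt_blackScholes_marginal_brownian_marginal
    (l : ℕ) (t : ℝ) (ht : 0 < t) (Γ : Matrix (Fin l) (Fin l) ℝ) (hΓ : Γ.det ≠ 0) :
    relEnt
      ((multiGaussian l (fun i => -(t/2) * ∑ k, (Γ i k)^2) (t • (Γ * Γᵀ))).map
        (fun x i => Real.exp (x i)))
      (multiGaussian l (fun _ => 1) (t • (1 : Matrix (Fin l) (Fin l) ℝ)))
    = (((1/2 : ℝ) * (- Real.log (Γ * Γᵀ).det + t * ∑ i, ∑ k, (Γ i k)^2 - l
        + (∑ i, (Real.exp (t * ∑ k, (Γ i k)^2) - 1)) / t) : ℝ) : EReal) := by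
  set m : Fin l → ℝ := fun i => -(t/2) * ∑ k, (Γ i k)^2 with hm
  set A : Matrix (Fin l) (Fin l) ℝ := Real.sqrt t • Γ with hAdef
  have hst : 0 < Real.sqrt t := Real.sqrt_pos.2 ht
  have hA : A.det ≠ 0 := by
    rw [hAdef, Matrix.det_smul]
    exact mul_ne_zero (pow_ne_zero _ hst.ne') hΓ
  have hu : IsUnit A.det := isUnit_iff_ne_zero.2 hA
  have hAA : t • (Γ * Γᵀ) = A * Aᵀ := by
    rw [hAdef, Matrix.transpose_smul, Matrix.smul_mul, Matrix.mul_smul, smul_smul,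
      Real.mul_self_sqrt ht.le]
  have hd : 0 < (Γ * Γᵀ).det := by
    rw [Matrix.det_mul, Matrix.det_transpose]; exact mul_self_pos.2 hΓ
  have hdS : (A * Aᵀ).det = t ^ l * (Γ * Γᵀ).det := by
    rw [← hAA, Matrix.det_smul, Fintype.card_fin]
  have hdn : (t • (1 : Matrix (Fin l) (Fin l) ℝ)).det = t ^ l := by
    rw [Matrix.det_smul, Fintype.card_fin, Matrix.det_one, mul_one]
  have hinv : (t • (1 : Matrix (Fin l) (Fin l) ℝ))⁻¹ = t⁻¹ • 1 := by
    apply Matrix.inv_eq_left_inv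
    rw [Matrix.smul_mul, Matrix.mul_smul, smul_smul, inv_mul_cancel₀ ht.ne', one_smul, Matrix.one_mul]
  rw [hAA]
  set g : (Fin l → ℝ) → ℝ := fun x => Real.exp (-(1/2) * ((x - m) ⬝ᵥ ((A * Aᵀ)⁻¹ *ᵥ (x - m)))) /
      Real.sqrt ((2 * Real.pi) ^ l * (A * Aᵀ).det) with hg
  set n : (Fin l → ℝ) → ℝ := fun x => Real.exp (-(1/2) * ((x - fun _ => 1) ⬝ᵥ
      ((t • (1 : Matrix (Fin l) (Fin l) ℝ))⁻¹ *ᵥ (x - fun _ => 1)))) /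
      Real.sqrt ((2 * Real.pi) ^ l * (t • (1 : Matrix (Fin l) (Fin l) ℝ)).det) with hn
  have hsg : 0 < Real.sqrt ((2 * Real.pi) ^ l * (A * Aᵀ).det) := by
    rw [hdS]; positivity
  have hsn : 0 < Real.sqrt ((2 * Real.pi) ^ l * (t • (1 : Matrix (Fin l) (Fin l) ℝ)).det) := by
    rw [hdn]; positivity
  have hgm : Measurable g := by
    apply Continuous.measurable
    rw [hg]
    fun_prop
  have hnm : Measurable n := by
    apply Continuous.measurable
    rw [hn]
    fun_prop
  obtain ⟨hac, hae⟩ := rn_core g n hgm hnm (fun x => div_pos (Real.exp_pos _) hsg)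
    (fun x => div_pos (Real.exp_pos _) hsn)
  have hmu : multiGaussian l m (A * Aᵀ) = volume.withDensity (fun x => ENNReal.ofReal (g x)) := rfl
  have hnu : multiGaussian l (fun _ => 1) (t • (1 : Matrix (Fin l) (Fin l) ℝ)) =
    volume.withDensity (fun x => ENNReal.ofReal (n x)) := rfl
  rw [← hmu, ← hnu] at hac hae
  set ν := multiGaussian l (fun _ => 1) (t • (1 : Matrix (Fin l) (Fin l) ℝ))
  set μ := (multiGaussian l m (A * Aᵀ)).map (fun x i => Real.exp (x i)) with hμ
  obtain ⟨F1, F2⟩ := F_int (-(1/2) * Real.log (Γ * Γᵀ).det) t ht Γ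
  set F := fun z : Fin l → ℝ => -(1/2) * Real.log (Γ * Γᵀ).det + ∑ i, (-(1/2) * z i ^ 2
        - (-(t/2) * ∑ k, (Γ i k)^2 + ∑ k, Real.sqrt t * Γ i k * z k)
        + 1 / (2 * t) * (Real.exp (-(t/2) * ∑ k, (Γ i k)^2 + ∑ k, Real.sqrt t * Γ i k * z k) - 1) ^ 2)
    with hF
  have hT : Measurable (fun z => m + A *ᵥ z) := by
    apply Continuous.measurable
    fun_prop
  have hE : Measurable (fun (x : Fin l → ℝ) i => Real.exp (x i)) := by fun_prop
  have hlog : Measurable (fun x => Real.log (μ.rnDeriv ν x).toReal) :=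
    (Measure.measurable_rnDeriv μ ν).ennreal_toReal.log
  rw [multiGaussian_eq_map m A hA] at hae
  have hae2 := ae_of_ae_map hT.aemeasurable hae
  have hFeq : (fun z => Real.log (μ.rnDeriv ν (fun i => Real.exp ((m + A *ᵥ z) i))).toReal)
      =ᵐ[Measure.pi (fun _ : Fin l => gaussianReal 0 1)] F := by
    filter_upwards [hae2] with z hz
    refine hz.trans ?_
    have h1 : (A *ᵥ z) ⬝ᵥ ((A * Aᵀ)⁻¹ *ᵥ (A *ᵥ z)) = z ⬝ᵥ z := by
      rw [Matrix.mul_inv_rev, Matrix.mulVec_mulVec, Matrix.mul_assoc, Matrix.nonsing_inv_mul _ hu,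
        Matrix.mul_one, Matrix.dotProduct_mulVec, ← Matrix.transpose_nonsing_inv,
        Matrix.vecMul_transpose, Matrix.mulVec_mulVec, Matrix.nonsing_inv_mul _ hu, Matrix.one_mulVec]
    simp only [hg, hn]
    rw [Real.log_div (Real.exp_pos _).ne' hsg.ne', Real.log_div (Real.exp_pos _).ne' hsn.ne',
      Real.log_exp, Real.log_exp, add_sub_cancel_left, h1, hinv, hdn, hdS, Real.log_sqrt (by positivity),
      Real.log_sqrt (by positivity), ← mul_assoc, Real.log_mul (by positivity) hd.ne',
      Matrix.smul_mulVec (t⁻¹) (1 : Matrix (Fin l) (Fin l) ℝ), Matrix.one_mulVec, dotProduct_smul]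
    have h2 : ∀ i, (m + A *ᵥ z) i = -(t/2) * ∑ k, (Γ i k)^2 + ∑ k, Real.sqrt t * Γ i k * z k := by
      intro i
      simp [hm, hAdef, Matrix.mulVec, dotProduct]
    simp only [h2, hF, dotProduct, Pi.sub_apply, smul_eq_mul, Finset.sum_add_distrib,
      Finset.sum_sub_distrib, ← Finset.mul_sum, ← sq]
    field_simp
    ring
  have hcomp : μ = (Measure.pi (fun _ : Fin l => gaussianReal 0 1)).map
      (fun z i => Real.exp ((m + A *ᵥ z) i)) := by
    rw [hμ, multiGaussian_eq_map m A hA, Measure.map_map hE hT]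
    rfl
  have hET : Measurable (fun z i => Real.exp ((m + A *ᵥ z) i)) := hE.comp hT
  have hint : Integrable (fun x => Real.log (μ.rnDeriv ν x).toReal) μ := by
    have : Integrable (fun x => Real.log (μ.rnDeriv ν x).toReal)
        ((Measure.pi (fun _ : Fin l => gaussianReal 0 1)).map
          (fun z i => Real.exp ((m + A *ᵥ z) i))) := by
      rw [integrable_map_measure hlog.aestronglyMeasurable hET.aemeasurable]
      exact F1.congr hFeq.symm
    rwa [← hcomp] at this
  have hval : ∫ x, Real.log (μ.rnDeriv ν x).toReal ∂μ = ∫ z, F z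
      ∂(Measure.pi (fun _ : Fin l => gaussianReal 0 1)) := by
    have : ∫ x, Real.log (μ.rnDeriv ν x).toReal ∂((Measure.pi (fun _ : Fin l => gaussianReal 0 1)).map
          (fun z i => Real.exp ((m + A *ᵥ z) i))) = ∫ z, F z
      ∂(Measure.pi (fun _ : Fin l => gaussianReal 0 1)) := by
      rw [integral_map hET.aemeasurable hlog.aestronglyMeasurable]
      exact integral_congr_ae hFeq
    rwa [← hcomp] at this
  rw [relEnt, if_pos ⟨hac, hint⟩, hval, F2]
  congr 1
  simp only [Finset.sum_add_distrib, ← Finset.mul_sum, Finset.sum_const, Finset.card_univ,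
    Fintype.card_fin, nsmul_eq_mul]
  field_simp
  ring

end
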